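/- Let κ be a regular uncountable cardinal and λ ≥ κ a cardinal. The following are equivalent: (1) κ is mildly λ-ineffable; (2) Sp(P_κλ)(delay-functions, nonempty) fails; (3) Sp(P_κλ)(delay-functions, covering) fails; (4) Sp(P_κλ)(delay-functions, unbounded) fails; (5) Sp(P_κλ)(delay-functions, stationary) fails. -/

import Mathlib

open Cardinal Set

/-- `P_κλ`: the collection of subsets of `λ` of size less than `κ`. -/
def Pkl (κ lam : Cardinal) : Set (Set Ordinal) :=
  {x | x ⊆ Set.Iio lam.ord ∧ Cardinal.mk ↥x < Cardinal.lift.{1,0} κ}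

/-- `U` is an unbounded (cofinal) subset of `P_κλ`. -/
def PklUnbdd (κ lam : Cardinal) (U : Set (Set Ordinal)) : Prop :=
  U ⊆ Pkl κ lam ∧ ∀ x ∈ Pkl κ lam, ∃ y ∈ U, x ⊆ y

/-- `C` is a club subset of `P_κλ`. -/
def PklClub (κ lam : Cardinal) (C : Set (Set Ordinal)) : Prop :=
  PklUnbdd κ lam C ∧
    ∀ o : Ordinal, 0 < o → o < κ.ord →
      ∀ c : Ordinal → Set Ordinal,
        (∀ i < o, c i ∈ C) → (∀ i j : Ordinal, i ≤ j → j < o → c i ⊆ c j) →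
        (⋃ i ∈ Set.Iio o, c i) ∈ C

/-- `S` is a stationary subset of `P_κλ`. -/
def PklStat (κ lam : Cardinal) (S : Set (Set Ordinal)) : Prop :=
  S ⊆ Pkl κ lam ∧ ∀ C, PklClub κ lam C → (S ∩ C).Nonempty

/-- `A` is covering: `⋃ A = λ`. -/
def PklCovering (lam : Cardinal) (A : Set (Set Ordinal)) : Prop :=
  ∀ ξ < lam.ord, ∃ x ∈ A, ξ ∈ x

/-- `f` is a delay function: `x ⊆ f x` for all `x ∈ P_κλ`. -/
def DelayFun (κ lam : Cardinal) (f : Set Ordinal → Set Ordinal) : Prop :=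
  ∀ x ∈ Pkl κ lam, x ⊆ f x ∧ f x ∈ Pkl κ lam

/-- `Sp(P_κλ)(delay-functions, ℬ)`: there is a `P_κλ`-list `d` such that every delay
function `f` is split by some `β < λ` into sets in `ℬ`. -/
def SpDelay (κ lam : Cardinal) (ℬ : Set (Set (Set Ordinal))) : Prop :=
  ∃ d : Set Ordinal → Set Ordinal, (∀ x ∈ Pkl κ lam, d x ⊆ x) ∧
    ∀ f, DelayFun κ lam f → ∃ β < lam.ord,
      {x | x ∈ Pkl κ lam ∧ β ∈ x ∧ β ∈ d (f x)} ∈ ℬ ∧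
      {x | x ∈ Pkl κ lam ∧ β ∈ x ∧ β ∉ d (f x)} ∈ ℬ

theorem Pkl.union {κ lam : Cardinal} (hreg : κ.IsRegular) {x y : Set Ordinal}
    (hx : x ∈ Pkl κ lam) (hy : y ∈ Pkl κ lam) : x ∪ y ∈ Pkl κ lam :=
  ⟨union_subset hx.1 hy.1,
    (mk_union_le x y).trans_lt (add_lt_of_lt hreg.lift.aleph0_le hx.2 hy.2)⟩

theorem Pkl.biUnion {κ lam : Cardinal} (hreg : κ.IsRegular) {I : Set Ordinal}
    (hI : #I < Cardinal.lift.{1, 0} κ) {c : Ordinal → Set Ordinal}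
    (hc : ∀ i ∈ I, c i ∈ Pkl κ lam) : (⋃ i ∈ I, c i) ∈ Pkl κ lam :=
  ⟨iUnion₂_subset fun i hi => (hc i hi).1,
    (card_biUnion_lt_iff_forall_of_isRegular hreg.lift hI).2 fun i hi => (hc i hi).2⟩

theorem Pkl.singleton_mem {κ lam : Cardinal} (hκ : ℵ₀ < κ) {ξ : Ordinal} (hξ : ξ < lam.ord) :
    {ξ} ∈ Pkl κ lam := by
  refine ⟨singleton_subset_iff.2 hξ, ?_⟩
  rw [mk_singleton, one_lt_lift_iff]
  exact one_lt_aleph0.trans hκ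

theorem PklClub.cone {κ lam : Cardinal} (hreg : κ.IsRegular) {a : Set Ordinal}
    (ha : a ∈ Pkl κ lam) : PklClub κ lam {x | x ∈ Pkl κ lam ∧ a ⊆ x} := by
  refine ⟨⟨fun x hx => hx.1, fun x hx =>
    ⟨x ∪ a, ⟨Pkl.union hreg hx ha, subset_union_right⟩, subset_union_left⟩⟩, ?_⟩
  intro o ho hoκ c hc _
  refine ⟨Pkl.biUnion hreg ?_ fun i hi => (hc i hi).1, ?_⟩
  · rw [mk_Iio_ordinal, lift_lt]
    exact lt_ord.1 hoκ
  · exact (hc 0 ho).2.trans (subset_biUnion_of_mem (u := c) (mem_Iio.2 ho))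

theorem PklStat.unbdd {κ lam : Cardinal} (hreg : κ.IsRegular) {S : Set (Set Ordinal)}
    (hS : PklStat κ lam S) : PklUnbdd κ lam S := by
  refine ⟨hS.1, fun x hx => ?_⟩
  obtain ⟨y, hyS, -, hxy⟩ := hS.2 _ (PklClub.cone hreg hx)
  exact ⟨y, hyS, hxy⟩

theorem PklUnbdd.covering {κ lam : Cardinal} (hκ : ℵ₀ < κ) {U : Set (Set Ordinal)}
    (hU : PklUnbdd κ lam U) : PklCovering lam U := by
  intro ξ hξ
  obtain ⟨y, hyU, hy⟩ := hU.2 _ (Pkl.singleton_mem hκ hξ)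
  exact ⟨y, hyU, hy rfl⟩

theorem PklClub.iUnion_nat_mem {κ lam : Cardinal} (hκ : ℵ₀ < κ) {C : Set (Set Ordinal)}
    (hC : PklClub κ lam C) {c : ℕ → Set Ordinal} (hc : ∀ n, c n ∈ C) (hmono : Monotone c) :
    (⋃ n, c n) ∈ C := by
  have key := hC.2 Ordinal.omega0 Ordinal.omega0_pos (omega0_lt_ord.2 hκ)
    (fun i => c (toNat i.card)) (fun i _ => hc _) (fun i j hij hj => by
      obtain ⟨n, rfl⟩ := Ordinal.lt_omega0.1 hj
      exact hmono (toNat_le_toNat (Ordinal.card_le_card hij) (by simp)))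
  convert key using 1
  ext ξ
  simp only [mem_iUnion, mem_Iio, exists_prop]
  constructor
  · rintro ⟨n, hn⟩
    exact ⟨n, Ordinal.natCast_lt_omega0 n, by simpa using hn⟩
  · rintro ⟨i, -, hi⟩
    exact ⟨_, hi⟩

/-- Fewer than `κ` many clubs have a common element above any given one. -/
theorem PklClub.exists_superset_forall_mem {κ lam : Cardinal} (hκ : ℵ₀ < κ)
    (hreg : κ.IsRegular) {I : Set Ordinal} (hI : #I < Cardinal.lift.{1, 0} κ)
    {C : Ordinal → Set (Set Ordinal)} (hC : ∀ i ∈ I, PklClub κ lam (C i)) {x : Set Ordinal}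
    (hx : x ∈ Pkl κ lam) : ∃ y ∈ Pkl κ lam, x ⊆ y ∧ ∀ i ∈ I, y ∈ C i := by
  have hg : ∀ i z, ∃ y, i ∈ I → z ∈ Pkl κ lam → y ∈ C i ∧ z ⊆ y := fun i z => by
    by_cases h : i ∈ I ∧ z ∈ Pkl κ lam
    · obtain ⟨y, hy⟩ := (hC i h.1).1.2 z h.2
      exact ⟨y, fun _ _ => hy⟩
    · exact ⟨z, fun hi hz => (h ⟨hi, hz⟩).elim⟩
  choose g hg using hg
  let s : ℕ → Set Ordinal := Nat.rec x fun _ z => z ∪ ⋃ i ∈ I, g i z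
  have hs : ∀ n, s n ∈ Pkl κ lam := by
    intro n
    induction n with
    | zero => exact hx
    | succ n ih =>
      exact Pkl.union hreg ih
        (Pkl.biUnion hreg hI fun i hi => (hC i hi).1.1 (hg i _ hi ih).1)
  have hmono : Monotone s := monotone_nat_of_le_succ fun n => subset_union_left
  have hgs : ∀ i ∈ I, ∀ n, g i (s n) ⊆ s (n + 1) := fun i hi n =>
    (subset_biUnion_of_mem (u := fun i => g i (s n)) hi).trans subset_union_right
  have hxs : x ⊆ ⋃ n, s n := subset_iUnion s 0
  have hmem : ∀ i ∈ I, (⋃ n, s n) ∈ C i := by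
    intro i hi
    have heq : (⋃ n, s n) = ⋃ n, g i (s n) :=
      (iUnion_mono fun n => (hg i _ hi (hs n)).2).antisymm
        (iUnion_subset fun n => (hgs i hi n).trans (subset_iUnion s (n + 1)))
    rw [heq]
    exact (hC i hi).iUnion_nat_mem hκ (fun n => (hg i _ hi (hs n)).1)
      (monotone_nat_of_le_succ fun n => (hgs i hi n).trans (hg i _ hi (hs (n + 1))).2)
  have hcone := PklClub.cone hreg hx
  exact ⟨_, (hcone.iUnion_nat_mem hκ (fun n => ⟨hs n, hmono (Nat.zero_le n)⟩) hmono).1,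
    hxs, hmem⟩

theorem SpDelay.mono {κ lam : Cardinal} {𝒜 ℬ : Set (Set (Set Ordinal))} (h : 𝒜 ⊆ ℬ)
    (hA : SpDelay κ lam 𝒜) : SpDelay κ lam ℬ := by
  obtain ⟨d, hd, hsp⟩ := hA
  refine ⟨d, hd, fun f hf => ?_⟩
  obtain ⟨β, hβ, hpos, hneg⟩ := hsp f hf
  exact ⟨β, hβ, h hpos, h hneg⟩

theorem not_spDelay_nonempty_of_branches {κ lam : Cardinal}
    (hbranch : ∀ d : Set Ordinal → Set Ordinal, (∀ x ∈ Pkl κ lam, d x ⊆ x) →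
      ∃ B : Set Ordinal, B ⊆ Set.Iio lam.ord ∧
        ∀ x ∈ Pkl κ lam, ∃ y ∈ Pkl κ lam, x ⊆ y ∧ d y ∩ x = B ∩ x) :
    ¬ SpDelay κ lam {A | A ⊆ Pkl κ lam ∧ A.Nonempty} := by
  rintro ⟨d, hd, hsp⟩
  obtain ⟨B, -, hB⟩ := hbranch d hd
  choose! f hf hsub hfB using hB
  obtain ⟨β, -, ⟨-, x, hx, hβx, hdx⟩, -, y, hy, hβy, hdy⟩ :=
    hsp f fun x hx => ⟨hsub x hx, hf x hx⟩
  have hβB : β ∈ B := ((hfB x hx).subset ⟨hdx, hβx⟩).1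
  exact hdy ((hfB y hy).superset ⟨hβB, hβy⟩).1

theorem exists_branch_of_not_spDelay_stat {κ lam : Cardinal} (hκ : ℵ₀ < κ)
    (hreg : κ.IsRegular) (hsp : ¬ SpDelay κ lam {A | PklStat κ lam A})
    {d : Set Ordinal → Set Ordinal} (hd : ∀ x ∈ Pkl κ lam, d x ⊆ x) :
    ∃ B : Set Ordinal, B ⊆ Set.Iio lam.ord ∧
      ∀ x ∈ Pkl κ lam, ∃ y ∈ Pkl κ lam, x ⊆ y ∧ d y ∩ x = B ∩ x := by
  have hf : ∃ f, DelayFun κ lam f ∧ ∀ β < lam.ord,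
      PklStat κ lam {x | x ∈ Pkl κ lam ∧ β ∈ x ∧ β ∈ d (f x)} →
      ¬ PklStat κ lam {x | x ∈ Pkl κ lam ∧ β ∈ x ∧ β ∉ d (f x)} := by
    by_contra! h
    exact hsp ⟨d, hd, h⟩
  obtain ⟨f, hf, hdich⟩ := hf
  let B : Set Ordinal :=
    {β | β < lam.ord ∧ PklStat κ lam {x | x ∈ Pkl κ lam ∧ β ∈ x ∧ β ∈ d (f x)}}
  have hclub : ∀ β, ∃ C, β < lam.ord →
      PklClub κ lam C ∧ ∀ x ∈ C, β ∈ x → (β ∈ d (f x) ↔ β ∈ B) := by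
    intro β
    by_cases hβ : β < lam.ord
    swap
    · exact ⟨∅, fun h => (hβ h).elim⟩
    have avoid : ∀ S ⊆ Pkl κ lam, ¬ PklStat κ lam S → ∃ C, PklClub κ lam C ∧ ∀ x ∈ C, x ∉ S := by
      intro S hS hns
      by_contra! h
      exact hns ⟨hS, fun C hC => let ⟨x, hxC, hxS⟩ := h C hC; ⟨x, hxS, hxC⟩⟩
    by_cases hB : β ∈ B
    · obtain ⟨C, hC, hCS⟩ := avoid _ (fun x hx => hx.1) (hdich β hβ hB.2)
      refine ⟨C, fun _ => ⟨hC, fun x hx hβx => iff_of_true ?_ hB⟩⟩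
      by_contra hn
      exact hCS x hx ⟨hC.1.1 hx, hβx, hn⟩
    · obtain ⟨C, hC, hCS⟩ := avoid _ (fun x hx => hx.1) fun h => hB ⟨hβ, h⟩
      exact ⟨C, fun _ => ⟨hC, fun x hx hβx =>
        iff_of_false (fun h => hCS x hx ⟨hC.1.1 hx, hβx, h⟩) hB⟩⟩
  choose C hC using hclub
  refine ⟨B, fun β hβ => hβ.1, fun x hx => ?_⟩
  obtain ⟨z, hz, hxz, hzC⟩ := PklClub.exists_superset_forall_mem hκ hreg hx.2
    (fun β hβ => (hC β (hx.1 hβ)).1) hx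
  refine ⟨f z, (hf z hz).2, hxz.trans (hf z hz).1, ?_⟩
  ext β
  exact and_congr_left fun hβ => (hC β (hx.1 hβ)).2 z (hzC β hβ) (hxz hβ)

/-- For a regular uncountable `κ` and `λ ≥ κ`, the following are equivalent:
`κ` is mildly `λ`-ineffable; `Sp(P_κλ)(delay-functions, nonempty)` fails;
`Sp(P_κλ)(delay-functions, covering)` fails; `Sp(P_κλ)(delay-functions, unbounded)`
fails; `Sp(P_κλ)(delay-functions, stationary)` fails. -/
theorem mildly_ineffable_tfae (κ lam : Cardinal) (hκ : ℵ₀ < κ)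
    (hreg : κ.IsRegular) (hkl : κ ≤ lam) :
    [(∀ d : Set Ordinal → Set Ordinal, (∀ x ∈ Pkl κ lam, d x ⊆ x) →
        ∃ B : Set Ordinal, B ⊆ Set.Iio lam.ord ∧
          ∀ x ∈ Pkl κ lam, ∃ y ∈ Pkl κ lam, x ⊆ y ∧ d y ∩ x = B ∩ x),
      ¬ SpDelay κ lam {A | A ⊆ Pkl κ lam ∧ A.Nonempty},
      ¬ SpDelay κ lam {A | A ⊆ Pkl κ lam ∧ PklCovering lam A},
      ¬ SpDelay κ lam {A | PklUnbdd κ lam A},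
      ¬ SpDelay κ lam {A | PklStat κ lam A}].TFAE := by
  tfae_have 1 → 2 := not_spDelay_nonempty_of_branches
  tfae_have 2 → 3 := mt <| SpDelay.mono fun A hA =>
    let ⟨x, hx, _⟩ := hA.2 0 (hreg.ord_pos.trans_le (ord_le_ord.2 hkl))
    ⟨hA.1, x, hx⟩
  tfae_have 3 → 4 := mt <| SpDelay.mono fun A hA => ⟨hA.1, hA.covering hκ⟩
  tfae_have 4 → 5 := mt <| SpDelay.mono fun A hA => PklStat.unbdd hreg hA
  tfae_have 5 → 1 := fun h d hd => exists_branch_of_not_spDelay_stat hκ hreg h hd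
  tfae_finish
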